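/- Upper bound on the ratio with the bounded fundamental solution, half-space instance (Lemma 4.4 for the fractional Laplacian, where φ⁻(x) = (x_N)₊^α and β⁻ = −α). Let N ≥ 2, α ∈ (0,1), H = {x ∈ ℝ^N : x_N > 0}. Let u : ℝ^N → ℝ be continuous with u ≥ 0 on ℝ^N, u(x) > 0 for all x ∈ H, and such that for every x ∈ H the function y ↦ δ(u,x,y) |y|^{−(N+2α)} is Lebesgue integrable with ∫_{ℝ^N} δ(u,x,y) |y|^{−(N+2α)} dy ≤ 0. Then for all 0 < s < t there exist constants C > 0 and r₁ > 0 (which may depend on u, s, t) such that for every r ≥ r₁: inf{ u(x)/(x_N)^α : x ∈ H, s r ≤ |x| ≤ t r } ≤ C. -/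

import Mathlib

open MeasureTheory

/-- The nonlocal second difference `δ(u,x,y) = u(x+y) + u(x-y) - 2u(x)`. -/
noncomputable def nlD {N : ℕ} (u : EuclideanSpace ℝ (Fin N) → ℝ)
    (x y : EuclideanSpace ℝ (Fin N)) : ℝ :=
  u (x + y) + u (x - y) - 2 * u x

section Aux
open Set Filter Topology

/-- Positive part power. -/
noncomputable def pospow (α s : ℝ) : ℝ := (max s 0) ^ α

lemma pospow_nonneg (α s : ℝ) : 0 ≤ pospow α s := Real.rpow_nonneg (le_max_right _ _) _

lemma pospow_continuous {α : ℝ} (h : 0 < α) : Continuous (pospow α) := by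
  unfold pospow
  exact (continuous_id.max continuous_const).rpow_const (fun _ => Or.inr h.le)

lemma pospow_of_nonneg {α s : ℝ} (h : 0 ≤ s) : pospow α s = s ^ α := by
  rw [pospow, max_eq_left h]

lemma pospow_of_nonpos {α s : ℝ} (hα : 0 < α) (h : s ≤ 0) : pospow α s = 0 := by
  rw [pospow, max_eq_right h, Real.zero_rpow hα.ne']

lemma pospow_mul {α c s : ℝ} (hc : 0 ≤ c) : pospow α (c * s) = c ^ α * pospow α s := by
  have : max (c * s) 0 = c * max s 0 := by
    rw [mul_max_of_nonneg _ _ hc, mul_zero]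
  rw [pospow, pospow, this, Real.mul_rpow hc (le_max_right _ _)]

lemma pospow_mono {α s t : ℝ} (hα : 0 < α) (h : s ≤ t) : pospow α s ≤ pospow α t := by
  unfold pospow
  exact Real.rpow_le_rpow (le_max_right _ _) (max_le_max h le_rfl) hα.le

lemma pospow_quad_lower {α σ : ℝ} (h0 : 0 < α) (h1 : α < 1) :
    1 + α * σ - σ ^ 2 ≤ pospow α (1 + σ) := by
  rcases le_or_gt σ (-1) with h | h
  · rw [pospow_of_nonpos h0 (by linarith)]
    nlinarith
  · rw [pospow_of_nonneg (by linarith)]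
    have hp : 0 < 1 + σ := by linarith
    have hB := rpow_one_add_le_one_add_mul_self (s := σ) (by linarith) (p := 1 - α)
      (by linarith) (by linarith)
    have hmul : (1 + σ) ^ α * (1 + σ) ^ (1 - α) = 1 + σ := by
      rw [← Real.rpow_add hp]; simp
    have hpos : 0 < (1 + σ) ^ α := Real.rpow_pos_of_pos hp _
    have hD : 0 < 1 + (1 - α) * σ := by nlinarith
    have h2 : 1 + σ ≤ (1 + σ) ^ α * (1 + (1 - α) * σ) := by
      calc 1 + σ = (1 + σ) ^ α * (1 + σ) ^ (1 - α) := hmul.symm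
        _ ≤ _ := mul_le_mul_of_nonneg_left hB hpos.le
    have h3 : (1 + α * σ - σ ^ 2) * (1 + (1 - α) * σ) ≤ 1 + σ := by
      have : 0 ≤ σ ^ 2 * ((1 + (1 - α) * σ) - α * (1 - α)) := by
        apply mul_nonneg (sq_nonneg _)
        nlinarith
      nlinarith
    exact le_of_mul_le_mul_right (h3.trans h2) hD

lemma pospow_quad_upper {α σ : ℝ} (h0 : 0 < α) (h1 : α < 1) :
    pospow α (1 + σ) ≤ 1 + α * σ + σ ^ 2 := by
  rcases le_or_gt σ (-1) with h | h
  · rw [pospow_of_nonpos h0 (by linarith)]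
    nlinarith [sq_nonneg (σ + α / 2)]
  · rw [pospow_of_nonneg (by linarith)]
    have hB := rpow_one_add_le_one_add_mul_self (s := σ) (by linarith) (p := α)
      (by linarith) (by linarith)
    nlinarith [sq_nonneg σ]

/-- one-sided one dimensional kernel -/
noncomputable def FF (α a b t : ℝ) : ℝ := pospow α ((b - t) * (a + t)) * t ^ (-1 - 2 * α)

lemma FF_nonneg {α a b t : ℝ} (ht : 0 ≤ t) : 0 ≤ FF α a b t :=
  mul_nonneg (pospow_nonneg _ _) (Real.rpow_nonneg ht _)

lemma FF_contOn {α a b : ℝ} (h : 0 < α) : ContinuousOn (FF α a b) (Ioi 0) := by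
  unfold FF
  apply ContinuousOn.mul
  · exact ((pospow_continuous h).comp (by fun_prop)).continuousOn
  · exact ContinuousOn.rpow_const continuousOn_id (fun x hx => Or.inl (ne_of_gt hx))

lemma FF_intble {α a b x y : ℝ} (h : 0 < α) (hx : 0 < x) (hy : 0 < y) :
    IntervalIntegrable (FF α a b) volume x y := by
  apply ContinuousOn.intervalIntegrable
  apply (FF_contOn h).mono
  intro z hz
  exact lt_of_lt_of_le (lt_min hx hy) hz.1

lemma FF_eq {α a b t : ℝ} (ht : 0 < t) :
    FF α a b t = pospow α ((b * t⁻¹ - 1) * (a * t⁻¹ + 1)) * t⁻¹ := by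
  have : (b - t) * (a + t) = t ^ 2 * ((b * t⁻¹ - 1) * (a * t⁻¹ + 1)) := by
    field_simp
  rw [FF, this, pospow_mul (by positivity)]
  have h2 : (t ^ 2) ^ α * t ^ (-1 - 2 * α) = t⁻¹ := by
    rw [← Real.rpow_natCast t 2, ← Real.rpow_mul ht.le, ← Real.rpow_add ht, ← Real.rpow_neg_one]
    congr 1
    push_cast; ring
  rw [← h2]; ring

lemma sub_one {α a b ρ : ℝ} (h0 : 0 < α) (ha : 0 < a) (hb : 0 < b) (hρ : 0 ≤ ρ) :
    ∫ t in (ρ + b⁻¹)⁻¹..b, FF α a b t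
      = ∫ x in (0:ℝ)..ρ, pospow α (x * (a * b * x + a + b)) * (x + b⁻¹)⁻¹ := by
  have key := intervalIntegral.integral_comp_mul_deriv' (a := 0) (b := ρ)
    (f := fun x => (x + b⁻¹)⁻¹) (f' := fun x => -1 / (x + b⁻¹) ^ 2) (g := FF α a b) ?_ ?_ ?_
  · simp only [zero_add, inv_inv] at key
    rw [intervalIntegral.integral_symm, ← key, ← intervalIntegral.integral_neg]
    apply intervalIntegral.integral_congr
    intro x hx
    rw [uIcc_of_le hρ] at hx
    have hxp : 0 < x + b⁻¹ := add_pos_of_nonneg_of_pos hx.1 (by positivity)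
    simp only [Function.comp]
    rw [FF_eq (by positivity), inv_inv]
    have : (b * (x + b⁻¹) - 1) * (a * (x + b⁻¹) + 1) = x * (a * b * x + a + b) := by
      field_simp; ring
    rw [this]
    field_simp
  · intro x hx
    rw [uIcc_of_le hρ] at hx
    have hxp : 0 < x + b⁻¹ := add_pos_of_nonneg_of_pos hx.1 (by positivity)
    exact ((hasDerivAt_id x).add_const b⁻¹).inv hxp.ne'
  · rw [uIcc_of_le hρ]
    apply ContinuousOn.div continuousOn_const (by fun_prop)
    intro x hx
    have hxp : 0 < x + b⁻¹ := add_pos_of_nonneg_of_pos hx.1 (by positivity)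
    positivity
  · apply (FF_contOn h0).mono
    rintro _ ⟨x, hx, rfl⟩
    rw [uIcc_of_le hρ] at hx
    have hxp : 0 < x + b⁻¹ := add_pos_of_nonneg_of_pos hx.1 (by positivity)
    simpa using hxp

lemma sub_two {α a b ρ : ℝ} (h0 : 0 < α) (ha : 0 < a) (hb : 0 < b) (hρ : 0 ≤ ρ) :
    (∫ t in (ρ + b⁻¹)⁻¹..b, FF α a b t) + (∫ t in (ρ + a⁻¹)⁻¹..a, FF α b a t)
      = ∫ q in (0:ℝ)..(ρ * (a * b * ρ + a + b)), pospow α q / (q + 1) := by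
  have hQ : ∀ x ∈ Icc 0 ρ, 0 ≤ x * (a * b * x + a + b) := by
    intro x hx; have := hx.1; positivity
  have key := intervalIntegral.integral_comp_mul_deriv' (a := 0) (b := ρ)
    (f := fun x => x * (a * b * x + a + b)) (f' := fun x => 2 * a * b * x + a + b)
    (g := fun q => pospow α q / (q + 1)) ?_ ?_ ?_
  · simp only [zero_mul] at key
    rw [← key, sub_one h0 ha hb hρ, sub_one h0 hb ha hρ, ← intervalIntegral.integral_add]
    · apply intervalIntegral.integral_congr
      intro x hx
      rw [uIcc_of_le hρ] at hx
      have := hQ x hx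
      have h1 : 0 < b * x + 1 := by have := hx.1; positivity
      have h2 : 0 < a * x + 1 := by have := hx.1; positivity
      have e1 : (x + b⁻¹)⁻¹ = b / (b * x + 1) := by field_simp
      have e2 : (x + a⁻¹)⁻¹ = a / (a * x + 1) := by field_simp
      have e3 : x * (a * b * x + a + b) + 1 = (b * x + 1) * (a * x + 1) := by ring
      have e4 : x * (b * a * x + b + a) = x * (a * b * x + a + b) := by ring
      simp only [Function.comp]
      rw [e1, e2, e3, e4]
      generalize pospow α (x * (a * b * x + a + b)) = X
      have n1 := h1.ne'
      have n2 := h2.ne'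
      generalize hA : b * x + 1 = A at *
      generalize hB : a * x + 1 = B at *
      field_simp
      rw [← hA, ← hB]
      ring
    · apply ContinuousOn.intervalIntegrable
      rw [uIcc_of_le hρ]
      apply ContinuousOn.mul
      · exact ((pospow_continuous h0).comp (by fun_prop)).continuousOn
      · apply ContinuousOn.inv₀ (by fun_prop)
        intro x hx
        have hxp : 0 < x + b⁻¹ := add_pos_of_nonneg_of_pos hx.1 (by positivity)
        exact hxp.ne'
    · apply ContinuousOn.intervalIntegrable
      rw [uIcc_of_le hρ]
      apply ContinuousOn.mul
      · exact ((pospow_continuous h0).comp (by fun_prop)).continuousOn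
      · apply ContinuousOn.inv₀ (by fun_prop)
        intro x hx
        have hxp : 0 < x + a⁻¹ := add_pos_of_nonneg_of_pos hx.1 (by positivity)
        exact hxp.ne'
  · intro x hx
    have h : HasDerivAt (fun x => x * (a * b * x + a + b))
        (1 * (a * b * x + a + b) + x * (a * b * 1)) x :=
      (hasDerivAt_id x).mul ((((hasDerivAt_id x).const_mul (a * b)).add_const a).add_const b)
    convert h using 1
    ring
  · fun_prop
  · apply ContinuousOn.div (pospow_continuous h0).continuousOn (by fun_prop)
    rintro _ ⟨x, hx, rfl⟩
    rw [uIcc_of_le hρ] at hx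
    have := hQ x hx
    positivity

lemma psi_lower {α Q : ℝ} (h0 : 0 < α) (h1 : α < 1) (hQ : 1 ≤ Q) :
    Q ^ α / α - (1 / α + 1 / (1 - α)) ≤ ∫ q in (0:ℝ)..Q, pospow α q / (q + 1) := by
  have hint : ∀ x y : ℝ, 0 ≤ x → 0 ≤ y →
      IntervalIntegrable (fun q => pospow α q / (q + 1)) volume x y := by
    intro x y hx hy
    apply ContinuousOn.intervalIntegrable
    apply ContinuousOn.div (pospow_continuous h0).continuousOn (by fun_prop)
    intro q hq
    have : 0 ≤ q := le_trans (le_min hx hy) hq.1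
    positivity
  rw [← intervalIntegral.integral_add_adjacent_intervals (hint 0 1 le_rfl zero_le_one)
    (hint 1 Q zero_le_one (by linarith))]
  have hA : 0 ≤ ∫ q in (0:ℝ)..1, pospow α q / (q + 1) := by
    apply intervalIntegral.integral_nonneg zero_le_one
    intro q hq
    exact div_nonneg (pospow_nonneg _ _) (by linarith [hq.1])
  have hn : (0:ℝ) ∉ uIcc 1 Q := by
    rw [uIcc_of_le hQ]; intro h; linarith [h.1]
  have i1 : IntervalIntegrable (fun q : ℝ => q ^ (α - 1)) volume 1 Q :=
    intervalIntegral.intervalIntegrable_rpow (Or.inr hn)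
  have i2 : IntervalIntegrable (fun q : ℝ => q ^ (α - 2)) volume 1 Q :=
    intervalIntegral.intervalIntegrable_rpow (Or.inr hn)
  have hB : ∫ q in (1:ℝ)..Q, (q ^ (α - 1) - q ^ (α - 2)) ≤ ∫ q in (1:ℝ)..Q, pospow α q / (q + 1) := by
    apply intervalIntegral.integral_mono_on hQ (i1.sub i2) (hint 1 Q zero_le_one (by linarith))
    intro q hq
    have hq0 : 0 < q := by linarith [hq.1]
    rw [pospow_of_nonneg hq0.le, le_div_iff₀ (by linarith)]
    have e1 : q ^ (α - 1) = q ^ (α - 2) * q := by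
      rw [← Real.rpow_add_one hq0.ne']; congr 1; ring
    have e2 : q ^ α = q ^ (α - 2) * q * q := by
      rw [← Real.rpow_add_one hq0.ne', ← Real.rpow_add_one hq0.ne']; congr 1; ring
    have := Real.rpow_pos_of_pos hq0 (α - 2)
    rw [e1, e2]; nlinarith
  rw [intervalIntegral.integral_sub i1 i2, integral_rpow (Or.inr ⟨by linarith, hn⟩),
    integral_rpow (Or.inr ⟨by linarith, hn⟩)] at hB
  have e3 : α - 1 + 1 = α := by ring
  have e4 : α - 2 + 1 = -(1 - α) := by ring
  rw [e3, e4, Real.one_rpow, Real.one_rpow, div_neg] at hB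
  have := Real.rpow_nonneg (by linarith : 0 ≤ Q) (-(1 - α))
  have h5 : 0 ≤ Q ^ (-(1 - α)) / (1 - α) := div_nonneg this (by linarith)
  rw [sub_div, sub_div] at hB
  linarith

lemma oneD_trunc {α a b ε : ℝ} (h0 : 0 < α) (h1 : α < 1) (ha : 0 < a) (hab : a ≤ b)
    (hε : 0 < ε) (hεa : ε < a) (hQ : 1 ≤ (b * ε⁻¹ + 1) * (a * ε⁻¹ - 1)) :
    ((b * ε⁻¹ + 1) * (a * ε⁻¹ - 1)) ^ α / α
      + ((b * ε⁻¹ + 1) * (a * ε⁻¹ - 1)) ^ α * (ε * (a⁻¹ - b⁻¹)) - (1 / α + 1 / (1 - α))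
      ≤ (∫ t in ε..b, FF α a b t) + ∫ t in ε..b, FF α b a t := by
  have hb : 0 < b := by linarith
  set Q := (b * ε⁻¹ + 1) * (a * ε⁻¹ - 1) with hQdef
  set ρ := ε⁻¹ - a⁻¹ with hρdef
  have hρ : 0 ≤ ρ := by
    have := (inv_le_inv₀ ha hε).2 hεa.le
    linarith
  have hQρ : ρ * (a * b * ρ + a + b) = Q := by
    rw [hQdef, hρdef]; field_simp; ring
  have e2 : (ρ + a⁻¹)⁻¹ = ε := by rw [hρdef]; simp
  have s2 := sub_two h0 ha hb hρ
  rw [hQρ, e2] at s2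
  set t1 := (ρ + b⁻¹)⁻¹ with ht1
  have hρb : 0 < ρ + b⁻¹ := by positivity
  have ht1p : 0 < t1 := by positivity
  have hba : b⁻¹ ≤ a⁻¹ := (inv_le_inv₀ hb ha).2 hab
  have hεt1 : ε ≤ t1 := by
    rw [ht1, le_inv_comm₀ hε hρb]
    linarith
  have p := psi_lower h0 h1 hQ
  rw [← s2] at p
  rw [← intervalIntegral.integral_add_adjacent_intervals (FF_intble h0 hε ht1p)
    (FF_intble h0 ht1p hb), ← intervalIntegral.integral_add_adjacent_intervals
    (FF_intble (a := b) (b := a) h0 hε ha) (FF_intble h0 ha hb)]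
  have n1 : 0 ≤ ∫ t in a..b, FF α b a t := by
    apply intervalIntegral.integral_nonneg hab
    intro t ht
    exact FF_nonneg (by linarith [ht.1])
  have n2 : Q ^ α * (ε * (a⁻¹ - b⁻¹)) ≤ ∫ t in ε..t1, FF α a b t := by
    have hc : ∫ t in ε..t1, Q ^ α * t1⁻¹ = Q ^ α * (ε * (a⁻¹ - b⁻¹)) := by
      rw [intervalIntegral.integral_const, smul_eq_mul]
      have : (t1 - ε) * t1⁻¹ = ε * (a⁻¹ - b⁻¹) := by
        rw [sub_mul, mul_inv_cancel₀ ht1p.ne', ht1, inv_inv, hρdef]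
        field_simp
        ring
      rw [← this]; ring
    rw [← hc]
    apply intervalIntegral.integral_mono_on hεt1 (by simp) (FF_intble h0 hε ht1p)
    intro t ht
    have htp : 0 < t := by linarith [ht.1]
    rw [FF_eq htp]
    have hti : t1⁻¹ ≤ t⁻¹ := (inv_le_inv₀ ht1p htp).2 ht.2
    have hti' : ρ + b⁻¹ ≤ t⁻¹ := by rwa [ht1, inv_inv] at hti
    apply mul_le_mul _ hti (by positivity) (pospow_nonneg _ _)
    rw [← pospow_of_nonneg (by linarith : 0 ≤ Q)]
    apply pospow_mono h0
    have eQ : Q = (b * (ρ + b⁻¹) - 1) * (a * (ρ + b⁻¹) + 1) := by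
      rw [← hQρ]; field_simp; ring
    rw [eQ]
    have g1 : 0 ≤ b * (ρ + b⁻¹) - 1 := by
      have : b * (ρ + b⁻¹) - 1 = b * ρ := by field_simp; ring
      rw [this]; positivity
    apply mul_le_mul
    · nlinarith
    · nlinarith
    · positivity
    · nlinarith
  linarith

/-- The symmetric one-dimensional second difference times the kernel. -/
noncomputable def HH (α a b t : ℝ) : ℝ :=
  (pospow α ((b - t) * (a + t)) + pospow α ((a - t) * (b + t)) - 2 * (a * b) ^ α)
    * t ^ (-1 - 2 * α)

lemma HH_eq (α a b t : ℝ) : HH α a b t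
    = FF α a b t + FF α b a t - 2 * (a * b) ^ α * t ^ (-1 - 2 * α) := by
  unfold HH FF; ring

lemma HH_trunc {α a b ε : ℝ} (h0 : 0 < α) (ha : 0 < a) (hab : a ≤ b)
    (hε : 0 < ε) (hεa : ε < a) (hint : IntegrableOn (HH α a b) (Ioi 0)) :
    ∫ t in Ioi ε, HH α a b t
      = (∫ t in ε..b, FF α a b t) + (∫ t in ε..b, FF α b a t)
        - (a * b) ^ α * ε ^ (-(2 * α)) / α := by
  have hb : 0 < b := by linarith
  have hεb : ε ≤ b := by linarith
  have hsplit := intervalIntegral.integral_interval_add_Ioi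
    (f := HH α a b) (a := ε) (b := b) (μ := volume)
    (hint.mono_set (Ioi_subset_Ioi hε.le)) (hint.mono_set (Ioi_subset_Ioi hb.le))
  rw [← hsplit]
  have hn : (0:ℝ) ∉ uIcc ε b := by
    rw [uIcc_of_le hεb]; intro h; linarith [h.1]
  have i3 : IntervalIntegrable (fun t : ℝ => t ^ (-1 - 2 * α)) volume ε b :=
    intervalIntegral.intervalIntegrable_rpow (Or.inr hn)
  have A : ∫ t in ε..b, HH α a b t = (∫ t in ε..b, FF α a b t) + (∫ t in ε..b, FF α b a t)
      - 2 * (a * b) ^ α * ∫ t in ε..b, t ^ (-1 - 2 * α) := by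
    simp_rw [HH_eq]
    rw [intervalIntegral.integral_sub ((FF_intble h0 hε hb).add (FF_intble h0 hε hb))
      (i3.const_mul _), intervalIntegral.integral_add (FF_intble h0 hε hb) (FF_intble h0 hε hb),
      intervalIntegral.integral_const_mul]
  have B : ∫ t in Ioi b, HH α a b t = - 2 * (a * b) ^ α * ∫ t in Ioi b, t ^ (-1 - 2 * α) := by
    rw [← integral_const_mul]
    apply setIntegral_congr_fun measurableSet_Ioi
    intro t ht
    have ht' : b < t := ht
    simp only [HH]
    rw [pospow_of_nonpos h0, pospow_of_nonpos h0]
    · ring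
    · apply mul_nonpos_of_nonpos_of_nonneg <;> linarith
    · apply mul_nonpos_of_nonpos_of_nonneg <;> linarith
  rw [A, B, integral_rpow (Or.inr ⟨by linarith, hn⟩), integral_Ioi_rpow_of_lt (by linarith) hb]
  have e : -1 - 2 * α + 1 = -(2 * α) := by ring
  rw [e]
  field_simp
  ring

lemma HH_lower_aux {α a b ε : ℝ} (h0 : 0 < α) (h1 : α < 1) (ha : 0 < a) (hab : a ≤ b)
    (hε : 0 < ε) (hεa : ε < a) (hQ : 1 ≤ (b * ε⁻¹ + 1) * (a * ε⁻¹ - 1))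
    (hint : IntegrableOn (HH α a b) (Ioi 0)) :
    -(1 / α + 1 / (1 - α)) - (a * b) ^ α * ε ^ (2 - 2 * α) *
      (α / (a * b) + ((a⁻¹ - b⁻¹) + ε / (a * b)) ^ 2
        + α ^ 2 * (a⁻¹ - b⁻¹) * ((a⁻¹ - b⁻¹) + ε / (a * b))
        + α * (a⁻¹ - b⁻¹) * ((a⁻¹ - b⁻¹) + ε / (a * b)) ^ 2 * ε) / α
      ≤ ∫ t in Ioi ε, HH α a b t := by
  have hb : 0 < b := by linarith
  rw [HH_trunc h0 ha hab hε hεa hint]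
  have T := oneD_trunc h0 h1 ha hab hε hεa hQ
  refine le_trans ?_ (sub_le_sub_right T _)
  set D := a⁻¹ - b⁻¹ with hD
  have hba : b⁻¹ ≤ a⁻¹ := (inv_le_inv₀ hb ha).2 hab
  have hD0 : 0 ≤ D := by linarith
  set c := (a * b) ^ α * ε ^ (-(2 * α)) with hc
  have hc0 : 0 ≤ c := by positivity
  have eQ : (b * ε⁻¹ + 1) * (a * ε⁻¹ - 1)
      = (a * b * (ε⁻¹) ^ 2) * (1 + -(ε * D + ε ^ 2 / (a * b))) := by
    rw [hD]; field_simp; ring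
  have eP : ((b * ε⁻¹ + 1) * (a * ε⁻¹ - 1)) ^ α
      = c * pospow α (1 + -(ε * D + ε ^ 2 / (a * b))) := by
    rw [← pospow_of_nonneg (by linarith), eQ, pospow_mul (by positivity),
      Real.mul_rpow (by positivity) (by positivity), hc]
    congr 2
    rw [← Real.rpow_natCast, ← Real.rpow_mul (by positivity), Real.inv_rpow hε.le,
      ← Real.rpow_neg hε.le]
    norm_num
  rw [eP]
  have q := pospow_quad_lower (σ := -(ε * D + ε ^ 2 / (a * b))) h0 h1
  set Z := pospow α (1 + -(ε * D + ε ^ 2 / (a * b)))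
  have eε : (a * b) ^ α * ε ^ (2 - 2 * α) = c * ε ^ 2 := by
    rw [hc, mul_assoc, ← Real.rpow_natCast ε 2, ← Real.rpow_add hε]
    congr 2; push_cast; ring
  rw [eε]
  have m : c * (1 + α * (ε * D)) * (1 + α * -(ε * D + ε ^ 2 / (a * b))
      - (-(ε * D + ε ^ 2 / (a * b))) ^ 2) ≤ c * (1 + α * (ε * D)) * Z :=
    mul_le_mul_of_nonneg_left q (by positivity)
  have m2 := div_le_div_of_nonneg_right m h0.le
  have r1 : c * (1 + α * (ε * D)) * Z / α = c * Z / α + c * Z * (ε * D) := by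
    field_simp
  rw [r1] at m2
  have r2 : c * (1 + α * (ε * D)) * (1 + α * -(ε * D + ε ^ 2 / (a * b))
      - (-(ε * D + ε ^ 2 / (a * b))) ^ 2) / α = c / α - c * ε ^ 2 * (α / (a * b) + (D + ε / (a * b)) ^ 2
        + α ^ 2 * D * (D + ε / (a * b))
        + α * D * (D + ε / (a * b)) ^ 2 * ε) / α := by
    rw [← sub_div]
    congr 1
    generalize D = D'
    field_simp
    ring
  rw [r2] at m2
  linarith

lemma HH_lower_le {α a b : ℝ} (h0 : 0 < α) (h1 : α < 1) (ha : 0 < a) (hab : a ≤ b) :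
    -(1 / α + 1 / (1 - α)) ≤ ∫ t in Ioi 0, HH α a b t := by
  have hb : 0 < b := by linarith
  by_cases hint : IntegrableOn (HH α a b) (Ioi 0)
  swap
  · rw [integral_undef hint]
    have : 0 ≤ 1 / α + 1 / (1 - α) := by
      have : 0 < 1 - α := by linarith
      positivity
    linarith
  have cov : AECover (volume.restrict (Ioi (0:ℝ))) (𝓝[>] (0:ℝ)) (fun i : ℝ => Ioi i) :=
    aecover_Ioi_of_Ioi (tendsto_nhdsWithin_of_tendsto_nhds tendsto_id)
  have lim1 := cov.integral_tendsto_of_countably_generated hint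
  have lim2 : Tendsto (fun ε : ℝ => -(1 / α + 1 / (1 - α)) - (a * b) ^ α * ε ^ (2 - 2 * α) *
      (α / (a * b) + ((a⁻¹ - b⁻¹) + ε / (a * b)) ^ 2
        + α ^ 2 * (a⁻¹ - b⁻¹) * ((a⁻¹ - b⁻¹) + ε / (a * b))
        + α * (a⁻¹ - b⁻¹) * ((a⁻¹ - b⁻¹) + ε / (a * b)) ^ 2 * ε) / α) (𝓝[>] 0)
        (𝓝 (-(1 / α + 1 / (1 - α)))) := by
    apply tendsto_nhdsWithin_of_tendsto_nhds
    have cr : Continuous (fun ε : ℝ => ε ^ (2 - 2 * α)) :=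
      Real.continuous_rpow_const (by linarith)
    have : Continuous (fun ε : ℝ => -(1 / α + 1 / (1 - α)) - (a * b) ^ α * ε ^ (2 - 2 * α) *
      (α / (a * b) + ((a⁻¹ - b⁻¹) + ε / (a * b)) ^ 2
        + α ^ 2 * (a⁻¹ - b⁻¹) * ((a⁻¹ - b⁻¹) + ε / (a * b))
        + α * (a⁻¹ - b⁻¹) * ((a⁻¹ - b⁻¹) + ε / (a * b)) ^ 2 * ε) / α) := by
      fun_prop
    have t := this.tendsto 0
    rw [Real.zero_rpow (by linarith)] at t
    simpa using t
  refine le_of_tendsto_of_tendsto lim2 lim1 ?_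
  have ev : ∀ᶠ ε in 𝓝[>] (0:ℝ), ε < min (a / 2) b := by
    apply mem_nhdsWithin_of_mem_nhds
    exact Iio_mem_nhds (by positivity)
  filter_upwards [ev, self_mem_nhdsWithin] with ε h2 h3
  have h3' : 0 < ε := h3
  have h4 : ε < a / 2 := lt_of_lt_of_le h2 (min_le_left _ _)
  have h5 : ε < b := lt_of_lt_of_le h2 (min_le_right _ _)
  rw [Measure.restrict_restrict measurableSet_Ioi, inter_eq_left.2 (Ioi_subset_Ioi h3'.le)]
  apply HH_lower_aux h0 h1 ha hab h3' (by linarith) _ hint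
  have g1 : 2 ≤ a * ε⁻¹ := by
    rw [← div_eq_mul_inv, le_div_iff₀ h3']; linarith
  have g2 : 0 ≤ b * ε⁻¹ := by positivity
  nlinarith

lemma HH_lower {α a b : ℝ} (h0 : 0 < α) (h1 : α < 1) (ha : 0 < a) (hb : 0 < b) :
    -(1 / α + 1 / (1 - α)) ≤ ∫ t in Ioi 0, HH α a b t := by
  rcases le_total a b with h | h
  · exact HH_lower_le h0 h1 ha h
  · have : HH α a b = HH α b a := by
      ext t; unfold HH; rw [mul_comm a b]; ring
    rw [this]
    exact HH_lower_le h0 h1 hb h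

open scoped RealInnerProductSpace

lemma polar_lower {N : ℕ} [Nontrivial (EuclideanSpace ℝ (Fin N))] (f : EuclideanSpace ℝ (Fin N) → ℝ)
    (hf : Integrable f) (κ : ℝ)
    (h : ∀ θ : EuclideanSpace ℝ (Fin N), ‖θ‖ = 1 →
      -κ ≤ ∫ t in Ioi (0:ℝ), t ^ (N - 1) * f (t • θ)) :
    -(κ * (volume : Measure (EuclideanSpace ℝ (Fin N))).toSphere.real univ) ≤ ∫ y, f y := by
  set μ := (volume : Measure (EuclideanSpace ℝ (Fin N))) with hμ
  have mp := μ.measurePreserving_homeomorphUnitSphereProd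
  have hdim : Module.finrank ℝ (EuclideanSpace ℝ (Fin N)) = N := by simp
  rw [hdim] at mp
  set g : (Metric.sphere (0 : EuclideanSpace ℝ (Fin N)) 1) × Ioi (0:ℝ) → ℝ :=
    fun p => f (p.2.1 • p.1.1) with hg
  have hcomp : g ∘ (homeomorphUnitSphereProd (EuclideanSpace ℝ (Fin N))) = fun x => f x.1 := by
    ext x
    have hx : ‖x.1‖ ≠ 0 := norm_ne_zero_iff.2 x.2
    simp [hg, hx, smul_smul]
  have e1 : ∫ y, f y ∂μ = ∫ p, g p ∂(μ.toSphere.prod (.volumeIoiPow (N - 1))) := by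
    rw [← mp.integral_comp (Homeomorph.measurableEmbedding _)]
    change _ = ∫ x, (g ∘ (homeomorphUnitSphereProd (EuclideanSpace ℝ (Fin N)))) x ∂_
    rw [hcomp, integral_subtype_comap (measurableSet_singleton _).compl fun x ↦ f x,
        restrict_compl_singleton]
  have hgi : Integrable g (μ.toSphere.prod (.volumeIoiPow (N - 1))) := by
    rw [← mp.integrable_comp_emb (Homeomorph.measurableEmbedding _), hcomp]
    have := hf.integrableOn (s := ({(0 : EuclideanSpace ℝ (Fin N))}ᶜ : Set _))
    rwa [integrableOn_iff_comap_subtypeVal (measurableSet_singleton _).compl] at this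
  rw [e1, integral_prod _ hgi]
  have e2 : -(κ * μ.toSphere.real univ) = ∫ _θ, -κ ∂μ.toSphere := by
    rw [integral_const, smul_eq_mul]; ring
  rw [e2]
  apply integral_mono (integrable_const _) hgi.integral_prod_left
  intro θ
  have hθ : ‖θ.1‖ = 1 := by simp
  refine (h θ.1 hθ).trans (le_of_eq ?_)
  simp only [hg]
  rw [Measure.volumeIoiPow, integral_withDensity_eq_integral_toReal_smul (by fun_prop)
    (by simp)]
  rw [← integral_subtype_comap measurableSet_Ioi (fun t : ℝ => t ^ (N - 1) * f (t • θ.1))]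
  apply integral_congr_ae
  filter_upwards with t
  have : (0:ℝ) ≤ t.1 ^ (N - 1) := pow_nonneg (le_of_lt t.2) _
  simp [ENNReal.toReal_ofReal this]

/-- Getoor function on a ball. -/
noncomputable def ww {N : ℕ} (α : ℝ) (c : EuclideanSpace ℝ (Fin N)) (R : ℝ)
    (x : EuclideanSpace ℝ (Fin N)) : ℝ := pospow α (R ^ 2 - ‖x - c‖ ^ 2)

lemma ww_continuous {N : ℕ} {α : ℝ} (h0 : 0 < α) (c : EuclideanSpace ℝ (Fin N)) (R : ℝ) :
    Continuous (ww α c R) := by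
  unfold ww
  exact (pospow_continuous h0).comp (by fun_prop)

lemma ww_nlD_HH {N : ℕ} {α R : ℝ} (c x θ : EuclideanSpace ℝ (Fin N)) (hx : ‖x - c‖ < R)
    (hθ : ‖θ‖ = 1) : ∃ a b : ℝ, 0 < a ∧ 0 < b ∧ ∀ t : ℝ,
      nlD (ww α c R) x (t • θ) = pospow α ((b - t) * (a + t)) + pospow α ((a - t) * (b + t))
        - 2 * (a * b) ^ α := by
  set e := ⟪x - c, θ⟫ with he
  set A := R ^ 2 - ‖x - c‖ ^ 2 with hA
  have hAp : 0 < A := by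
    have := norm_nonneg (x - c)
    nlinarith
  have hs : |e| < √(e ^ 2 + A) := by
    rw [← Real.sqrt_sq_eq_abs]
    exact Real.sqrt_lt_sqrt (sq_nonneg _) (by linarith)
  have hsq : √(e ^ 2 + A) ^ 2 = e ^ 2 + A := Real.sq_sqrt (by positivity)
  have habs := abs_lt.1 hs
  refine ⟨e + √(e ^ 2 + A), -e + √(e ^ 2 + A), by linarith, by linarith, fun t => ?_⟩
  have hab : (e + √(e ^ 2 + A)) * (-e + √(e ^ 2 + A)) = A := by nlinarith
  have n1 : ‖x + t • θ - c‖ ^ 2 = ‖x - c‖ ^ 2 + 2 * t * e + t ^ 2 := by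
    have : x + t • θ - c = (x - c) + t • θ := by abel
    rw [this, norm_add_sq_real, inner_smul_right, norm_smul, hθ, mul_one, Real.norm_eq_abs, sq_abs]
    ring
  have n2 : ‖x - t • θ - c‖ ^ 2 = ‖x - c‖ ^ 2 - 2 * t * e + t ^ 2 := by
    have : x - t • θ - c = (x - c) - t • θ := by abel
    rw [this, norm_sub_sq_real, inner_smul_right, norm_smul, hθ, mul_one, Real.norm_eq_abs, sq_abs]
    ring
  rw [hab]
  unfold nlD ww
  rw [n1, n2, ← hA, pospow_of_nonneg hAp.le]
  congr 3
  · nlinarith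
  · nlinarith

lemma radial_integrable {N : ℕ} (hN : 2 ≤ N) [Nontrivial (EuclideanSpace ℝ (Fin N))]
    {α : ℝ} (h0 : 0 < α) (h1 : α < 1) :
    Integrable (fun y : EuclideanSpace ℝ (Fin N) =>
      min (‖y‖ ^ 2) 1 * ‖y‖ ^ (-((N : ℝ) + 2 * α))) := by
  have := (integrable_fun_norm_addHaar (volume : Measure (EuclideanSpace ℝ (Fin N)))
    (f := fun r : ℝ => min (r ^ 2) 1 * r ^ (-((N : ℝ) + 2 * α))))
  rw [this]
  have hdim : Module.finrank ℝ (EuclideanSpace ℝ (Fin N)) = N := by simp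
  rw [hdim]
  have hcast : ((N - 1 : ℕ) : ℝ) = (N : ℝ) - 1 := by
    rw [Nat.cast_sub (by omega)]; simp
  have hpw : ∀ y : ℝ, 0 < y → y ^ (N - 1) * y ^ (-((N : ℝ) + 2 * α)) = y ^ (-1 - 2 * α) := by
    intro y hy
    rw [← Real.rpow_natCast, ← Real.rpow_add hy, hcast]
    congr 1; ring
  rw [← Ioc_union_Ioi_eq_Ioi (zero_le_one (α := ℝ))]
  apply IntegrableOn.union
  · have i : IntegrableOn (fun y : ℝ => y ^ (1 - 2 * α)) (Ioc 0 1) := by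
      have := intervalIntegral.intervalIntegrable_rpow' (a := 0) (b := 1) (r := 1 - 2 * α) (by linarith)
      rwa [intervalIntegrable_iff_integrableOn_Ioc_of_le zero_le_one] at this
    apply i.congr_fun _ measurableSet_Ioc
    intro y hy
    have hy0 : 0 < y := hy.1
    have hm : min (y ^ 2) 1 = y ^ 2 := min_eq_left (by nlinarith [hy.2])
    simp only [smul_eq_mul]
    rw [hm]
    calc y ^ (1 - 2 * α) = y ^ 2 * y ^ (-1 - 2 * α) := by
          rw [← Real.rpow_natCast, ← Real.rpow_add hy0]; congr 1; push_cast; ring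
      _ = _ := by rw [← hpw y hy0]; ring
  · have i := integrableOn_Ioi_rpow_of_lt (a := -1 - 2 * α) (by linarith) (zero_lt_one (α := ℝ))
    apply i.congr_fun _ measurableSet_Ioi
    intro y hy
    have hy1 : 1 < y := hy
    have hm : min (y ^ 2) 1 = 1 := min_eq_right (by nlinarith)
    simp only [smul_eq_mul]
    rw [hm, one_mul, hpw y (by linarith)]

lemma ww_bound {N : ℕ} {α R : ℝ} (h0 : 0 < α) (h1 : α < 1) (c x : EuclideanSpace ℝ (Fin N))
    (hx : ‖x - c‖ < R) : ∃ C : ℝ, ∀ y, |nlD (ww α c R) x y| ≤ C * min (‖y‖ ^ 2) 1 := by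
  set A := R ^ 2 - ‖x - c‖ ^ 2 with hA
  have hAp : 0 < A := by
    have := norm_nonneg (x - c)
    nlinarith
  set B := (R ^ 2) ^ α with hB
  have hwB : ∀ z, ww α c R z ≤ B := by
    intro z
    rw [hB, ← pospow_of_nonneg (sq_nonneg R)]
    apply pospow_mono h0
    have := sq_nonneg ‖z - c‖
    linarith
  have hw0 : ∀ z, 0 ≤ ww α c R z := fun z => pospow_nonneg _ _
  set C1 := A ^ α * (2 * α / A + (8 * R ^ 2 + 2) / A ^ 2) with hC1
  have hC1p : 0 ≤ C1 := by positivity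
  have hBp : 0 ≤ B := by positivity
  refine ⟨C1 + 2 * B, fun y => ?_⟩
  have triv : |nlD (ww α c R) x y| ≤ 2 * B := by
    unfold nlD
    rw [abs_le]
    constructor <;> linarith [hwB x, hwB (x + y), hwB (x - y), hw0 x, hw0 (x + y), hw0 (x - y)]
  rcases le_total 1 (‖y‖ ^ 2) with h | h
  · rw [min_eq_right h]; linarith
  rw [min_eq_left h]
  set n := ‖y‖ with hn
  set e := ⟪x - c, y⟫ with he
  have n1 : R ^ 2 - ‖x + y - c‖ ^ 2 = A * (1 + (-2 * e - n ^ 2) / A) := by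
    have : x + y - c = (x - c) + y := by abel
    rw [this, norm_add_sq_real]
    field_simp; rw [hA]; ring
  have n2 : R ^ 2 - ‖x - y - c‖ ^ 2 = A * (1 + (2 * e - n ^ 2) / A) := by
    have : x - y - c = (x - c) - y := by abel
    rw [this, norm_sub_sq_real]
    field_simp; rw [hA]; ring
  have hD : nlD (ww α c R) x y = A ^ α * (pospow α (1 + (-2 * e - n ^ 2) / A)
      + pospow α (1 + (2 * e - n ^ 2) / A) - 2) := by
    unfold nlD ww
    rw [n1, n2, ← hA, pospow_mul hAp.le, pospow_mul hAp.le, pospow_of_nonneg hAp.le]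
    ring
  have l1 := pospow_quad_lower (σ := (-2 * e - n ^ 2) / A) h0 h1
  have l2 := pospow_quad_lower (σ := (2 * e - n ^ 2) / A) h0 h1
  have u1 := pospow_quad_upper (σ := (-2 * e - n ^ 2) / A) h0 h1
  have u2 := pospow_quad_upper (σ := (2 * e - n ^ 2) / A) h0 h1
  set X := pospow α (1 + (-2 * e - n ^ 2) / A)
  set Y := pospow α (1 + (2 * e - n ^ 2) / A)
  have hsum : α * ((-2 * e - n ^ 2) / A) + α * ((2 * e - n ^ 2) / A) = -(2 * α / A) * n ^ 2 := by
    ring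
  have hsq : ((-2 * e - n ^ 2) / A) ^ 2 + ((2 * e - n ^ 2) / A) ^ 2
      ≤ (8 * R ^ 2 + 2) / A ^ 2 * n ^ 2 := by
    have : ((-2 * e - n ^ 2) / A) ^ 2 + ((2 * e - n ^ 2) / A) ^ 2
        = (8 * e ^ 2 + 2 * n ^ 4) / A ^ 2 := by field_simp; ring
    rw [this, div_mul_eq_mul_div]
    apply div_le_div_of_nonneg_right _ (by positivity)
    have ce : e ^ 2 ≤ R ^ 2 * n ^ 2 := by
      have := abs_real_inner_le_norm (x - c) y
      rw [← he, ← hn] at this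
      have h2 : |e| ≤ R * n := this.trans (mul_le_mul_of_nonneg_right hx.le (norm_nonneg _))
      rw [← sq_abs, ← mul_pow]
      exact pow_le_pow_left₀ (abs_nonneg _) h2 2
    have : n ^ 4 ≤ n ^ 2 := by nlinarith [sq_nonneg n]
    nlinarith
  have hXY : |X + Y - 2| ≤ (2 * α / A + (8 * R ^ 2 + 2) / A ^ 2) * n ^ 2 := by
    have : 0 ≤ 2 * α / A * n ^ 2 := by positivity
    rw [abs_le]
    constructor <;> nlinarith
  rw [hD, abs_mul, abs_of_nonneg (by positivity : 0 ≤ A ^ α)]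
  have := mul_le_mul_of_nonneg_left hXY (by positivity : 0 ≤ A ^ α)
  have h3 : 0 ≤ 2 * B * n ^ 2 := by positivity
  rw [hC1]
  linarith

lemma ww_integrable {N : ℕ} (hN : 2 ≤ N) [Nontrivial (EuclideanSpace ℝ (Fin N))]
    {α R : ℝ} (h0 : 0 < α) (h1 : α < 1) (c x : EuclideanSpace ℝ (Fin N))
    (hx : ‖x - c‖ < R) :
    Integrable (fun y => nlD (ww α c R) x y * ‖y‖ ^ (-((N : ℝ) + 2 * α))) := by
  obtain ⟨C, hC⟩ := ww_bound h0 h1 c x hx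
  apply ((radial_integrable hN h0 h1).const_mul C).mono'
  · apply AEStronglyMeasurable.mul
    · apply Continuous.aestronglyMeasurable
      have := ww_continuous h0 c R
      unfold nlD
      fun_prop
    · apply Measurable.aestronglyMeasurable
      fun_prop
  · filter_upwards with y
    have hp : 0 ≤ ‖y‖ ^ (-((N : ℝ) + 2 * α)) := by positivity
    rw [norm_mul, Real.norm_eq_abs, Real.norm_eq_abs, abs_of_nonneg hp, ← mul_assoc]
    exact mul_le_mul_of_nonneg_right (hC y) hp

lemma ww_lower {N : ℕ} (hN : 2 ≤ N) [Nontrivial (EuclideanSpace ℝ (Fin N))]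
    {α R : ℝ} (h0 : 0 < α) (h1 : α < 1) (c x : EuclideanSpace ℝ (Fin N))
    (hx : ‖x - c‖ < R) :
    -((1 / α + 1 / (1 - α)) * (volume : Measure (EuclideanSpace ℝ (Fin N))).toSphere.real univ)
      ≤ ∫ y, nlD (ww α c R) x y * ‖y‖ ^ (-((N : ℝ) + 2 * α)) := by
  apply polar_lower _ (ww_integrable hN h0 h1 c x hx)
  intro θ hθ
  obtain ⟨a, b, ha, hb, hab⟩ := ww_nlD_HH (α := α) c x θ hx hθ
  refine (HH_lower h0 h1 ha hb).trans (le_of_eq ?_)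
  apply setIntegral_congr_fun measurableSet_Ioi
  intro t ht
  have ht0 : 0 < t := ht
  have hcast : ((N - 1 : ℕ) : ℝ) = (N : ℝ) - 1 := by
    rw [Nat.cast_sub (by omega)]; simp
  have hpw : t ^ (N - 1) * t ^ (-((N : ℝ) + 2 * α)) = t ^ (-1 - 2 * α) := by
    rw [← Real.rpow_natCast, ← Real.rpow_add ht0, hcast]
    congr 1; ring
  simp only
  rw [hab t, norm_smul, hθ, mul_one, Real.norm_of_nonneg ht0.le, HH, ← hpw]
  ring

lemma comparison {N : ℕ} (hN : 2 ≤ N) [Nontrivial (EuclideanSpace ℝ (Fin N))]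
    {α R : ℝ} (h0 : 0 < α) (h1 : α < 1) (c : EuclideanSpace ℝ (Fin N))
    (u : EuclideanSpace ℝ (Fin N) → ℝ) (hu : Continuous u) (hu0 : ∀ x, 0 ≤ u x)
    (hsup : ∀ x, ‖x - c‖ < R →
      Integrable (fun y => nlD u x y * ‖y‖ ^ (-((N : ℝ) + 2 * α))) ∧
      ∫ y, nlD u x y * ‖y‖ ^ (-((N : ℝ) + 2 * α)) ≤ 0)
    (hR : 0 < R)
    (K : Set (EuclideanSpace ℝ (Fin N))) (hK : MeasurableSet K) (hKf : volume K ≠ ⊤)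
    (M L : ℝ) (hM : 0 ≤ M) (hKM : ∀ y ∈ K, M ≤ u y) (hKc : ∀ y ∈ K, R ≤ ‖y - c‖)
    (hKL : ∀ y ∈ K, ∀ x, ‖x - c‖ < R → ‖y - x‖ ≤ L)
    (ε : ℝ) (hε0 : 0 ≤ ε)
    (hε : ε * ((1 / α + 1 / (1 - α)) *
      (volume : Measure (EuclideanSpace ℝ (Fin N))).toSphere.real univ)
      < M * L ^ (-((N : ℝ) + 2 * α)) * volume.real K) (x : EuclideanSpace ℝ (Fin N)) :
    ε * ww α c R x ≤ u x := by
  by_contra hcon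
  push Not at hcon
  set w := ww α c R with hw
  have hwc : Continuous w := ww_continuous h0 c R
  set v : EuclideanSpace ℝ (Fin N) → ℝ := fun x => u x - ε * w x with hv
  have hvc : Continuous v := by fun_prop
  have hout : ∀ z, R ≤ ‖z - c‖ → w z = 0 := by
    intro z hz
    apply pospow_of_nonpos h0
    nlinarith
  have hvout : ∀ z, R ≤ ‖z - c‖ → v z = u z := by
    intro z hz
    simp [hv, hout z hz]
  have hin : ∀ z, v z < 0 → ‖z - c‖ < R := by
    intro z hz
    by_contra h
    rw [hvout z (not_lt.1 h)] at hz
    linarith [hu0 z]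
  have hvx : v x < 0 := by simp only [hv]; linarith
  have hxin := hin x hvx
  obtain ⟨x0, -, hmin⟩ := (isCompact_closedBall c R).exists_isMinOn
    ⟨x, by rw [mem_closedBall_iff_norm]; exact hxin.le⟩ hvc.continuousOn
  have hvx0 : v x0 < 0 := lt_of_le_of_lt (hmin (by
    rw [mem_closedBall_iff_norm]; exact hxin.le)) hvx
  have hx0 := hin x0 hvx0
  have hglob : ∀ z, v x0 ≤ v z := by
    intro z
    rcases le_or_gt ‖z - c‖ R with h | h
    · exact hmin (by rw [mem_closedBall_iff_norm]; exact h)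
    · rw [hvout z h.le]; linarith [hu0 z]
  obtain ⟨iu, su⟩ := hsup x0 hx0
  have iw := ww_integrable hN h0 h1 c x0 hx0
  have lw := ww_lower hN h0 h1 c x0 hx0
  rw [← hw] at iw lw
  set k : EuclideanSpace ℝ (Fin N) → ℝ := fun y => ‖y‖ ^ (-((N : ℝ) + 2 * α)) with hk
  have hk0 : ∀ y, 0 ≤ k y := fun y => by simp only [hk]; positivity
  have iv : Integrable (fun y => nlD v x0 y * k y) := by
    have := iu.sub (iw.const_mul ε)
    refine this.congr ?_
    filter_upwards with y
    simp only [Pi.sub_apply, nlD, hv, hk]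
    ring
  have ev : ∫ y, nlD u x0 y * k y = (∫ y, nlD v x0 y * k y) + ε * ∫ y, nlD w x0 y * k y := by
    rw [← integral_const_mul, ← integral_add iv (iw.const_mul ε)]
    congr 1
    ext y
    simp only [nlD, hv, hk]
    ring
  set S : Set (EuclideanSpace ℝ (Fin N)) := (fun y => x0 + y) ⁻¹' K with hS
  have hSm : MeasurableSet S := hK.preimage (measurable_const_add x0)
  have hSv : volume S = volume K := measure_preimage_add volume x0 K
  have hδ : ∀ y, 0 ≤ nlD v x0 y := by
    intro y
    unfold nlD
    linarith [hglob (x0 + y), hglob (x0 - y)]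
  have lowS : M * L ^ (-((N : ℝ) + 2 * α)) * volume.real K ≤ ∫ y, nlD v x0 y * k y := by
    calc M * L ^ (-((N : ℝ) + 2 * α)) * volume.real K
        = ∫ y in S, M * L ^ (-((N : ℝ) + 2 * α)) := by
          rw [setIntegral_const, smul_eq_mul, measureReal_def, measureReal_def, hSv]; ring
      _ ≤ ∫ y in S, nlD v x0 y * k y := by
          apply setIntegral_mono_on _ iv.integrableOn hSm
          · intro y hy
            have hyK : x0 + y ∈ K := hy
            have hL := hKL _ hyK x0 hx0
            rw [add_sub_cancel_left] at hL
            have hyc := hKc _ hyK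
            have hyp : 0 < ‖y‖ := by
              rw [norm_pos_iff]
              rintro rfl
              rw [add_zero] at hyc
              linarith
            apply mul_le_mul _ _ (Real.rpow_nonneg (by linarith) _) (hδ y)
            · unfold nlD
              have := hvout _ hyc
              linarith [hglob (x0 - y), hKM _ hyK]
            · apply Real.rpow_le_rpow_of_nonpos hyp hL
              have : (0:ℝ) ≤ N := Nat.cast_nonneg _
              linarith
          · exact integrableOn_const (by rw [hSv]; exact hKf)
      _ ≤ ∫ y, nlD v x0 y * k y := by
          apply setIntegral_le_integral iv
          filter_upwards with y
          exact mul_nonneg (hδ y) (hk0 y)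
  have := mul_le_mul_of_nonneg_left lw hε0
  simp only [hk] at *
  linarith

end Aux

/-- Upper bound on the ratio of a positive supersolution with the bounded
fundamental solution `φ⁻(x) = (x_N)₊^α` in the half-space (Lemma 4.4 for the
fractional Laplacian). -/
theorem ratio_bound_halfspace
    (N : ℕ) (hN : 2 ≤ N) (α : ℝ) (hα : α ∈ Set.Ioo (0 : ℝ) 1)
    (u : EuclideanSpace ℝ (Fin N) → ℝ)
    (hu_cont : Continuous u)
    (hu_nonneg : ∀ x, 0 ≤ u x)
    (hu_pos : ∀ x : EuclideanSpace ℝ (Fin N), 0 < x ⟨N - 1, by omega⟩ → 0 < u x)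
    (hu_super : ∀ x : EuclideanSpace ℝ (Fin N), 0 < x ⟨N - 1, by omega⟩ →
      Integrable (fun y => nlD u x y * ‖y‖ ^ (-((N : ℝ) + 2 * α))) ∧
      ∫ y, nlD u x y * ‖y‖ ^ (-((N : ℝ) + 2 * α)) ≤ 0) :
    ∀ s t : ℝ, 0 < s → s < t →
      ∃ C : ℝ, 0 < C ∧ ∃ r₁ : ℝ, 0 < r₁ ∧
        ∀ r : ℝ, r₁ ≤ r →
          sInf ((fun x : EuclideanSpace ℝ (Fin N) =>
                u x / (x ⟨N - 1, by omega⟩) ^ α) ''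
              {x | 0 < x ⟨N - 1, by omega⟩ ∧ s * r ≤ ‖x‖ ∧ ‖x‖ ≤ t * r})
            ≤ C := by
  intro s t hs hst
  obtain ⟨h0, h1⟩ := hα
  set i : Fin N := ⟨N - 1, by omega⟩ with hi
  haveI : Nonempty (Fin N) := ⟨i⟩
  haveI : Nontrivial (EuclideanSpace ℝ (Fin N)) := inferInstance
  set e : (EuclideanSpace ℝ (Fin N)) := EuclideanSpace.single i 1 with he
  have hei : e i = 1 := by simp [he]
  have hen : ‖e‖ = 1 := by simp [he]
  have hcoord : ∀ x : (EuclideanSpace ℝ (Fin N)), |x i| ≤ ‖x‖ := fun x => PiLp.norm_apply_le x i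
  have hue : 0 < u e := hu_pos e (by rw [hei]; exact one_pos)
  set κ := (1 / α + 1 / (1 - α)) * (volume : Measure (EuclideanSpace ℝ (Fin N))).toSphere.real Set.univ with hκ
  have hκ0 : 0 ≤ κ := by
    have : 0 < 1 - α := by linarith
    positivity
  set V := (volume : Measure (EuclideanSpace ℝ (Fin N))).real (Metric.ball 0 1) with hV
  have hV0 : 0 < V := by
    rw [hV, measureReal_def]
    exact ENNReal.toReal_pos (Metric.measure_ball_pos _ _ one_pos).ne' measure_ball_lt_top.ne
  set c1 := s ^ α * (2 * t) ^ (-((N : ℝ) + 2 * α)) * ((t - s) / 2) ^ N * V with hc1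
  have ht : 0 < t := by linarith
  have hts : 0 < (t - s) / 2 := by linarith
  have hc10 : 0 < c1 := by positivity
  set c2 := c1 * (s / 4) ^ α / (κ + 1) with hc2
  have hc20 : 0 < c2 := by positivity
  refine ⟨u e / c2, by positivity, 4 / s, by positivity, fun r hr => ?_⟩
  have hr0 : 0 < r := lt_of_lt_of_le (by positivity) hr
  set A := ((fun x : (EuclideanSpace ℝ (Fin N)) => u x / (x i) ^ α) '' {x | 0 < x i ∧ s * r ≤ ‖x‖ ∧ ‖x‖ ≤ t * r}) with hA
  set m := sInf A with hm
  rcases le_or_gt m 0 with hm0 | hm0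
  · exact hm0.trans (by positivity)
  have hbdd : BddBelow A := by
    refine ⟨0, ?_⟩
    rintro _ ⟨x, hx, rfl⟩
    exact div_nonneg (hu_nonneg x) (Real.rpow_nonneg hx.1.le _)
  have hmu : ∀ x : (EuclideanSpace ℝ (Fin N)), 0 < x i → s * r ≤ ‖x‖ → ‖x‖ ≤ t * r → m * (x i) ^ α ≤ u x := by
    intro x hx1 hx2 hx3
    have : m ≤ u x / (x i) ^ α := csInf_le hbdd ⟨x, ⟨hx1, hx2, hx3⟩, rfl⟩
    rwa [le_div_iff₀ (Real.rpow_pos_of_pos hx1 _)] at this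
  set R := s * r / 4 with hR
  have hR1 : 1 ≤ R := by
    rw [div_le_iff₀ hs] at hr
    rw [hR]; linarith
  have hsr : s * r = 4 * R := by rw [hR]; ring
  have htr : s * r < t * r := mul_lt_mul_of_pos_right hst hr0
  set c : (EuclideanSpace ℝ (Fin N)) := R • e with hc
  have hci : c i = R := by simp [hc, hei]
  have hcn : ‖c‖ = R := by rw [hc, norm_smul, hen, mul_one, Real.norm_of_nonneg (by linarith)]
  set p : (EuclideanSpace ℝ (Fin N)) := ((s + t) / 2 * r) • e with hp
  have hpi : p i = (s + t) / 2 * r := by simp [hp, hei]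
  have hpn : ‖p‖ = (s + t) / 2 * r := by
    rw [hp, norm_smul, hen, mul_one, Real.norm_of_nonneg (by positivity)]
  set K := Metric.closedBall p ((t - s) / 2 * r) with hKdef
  have hKi : ∀ y ∈ K, s * r ≤ y i ∧ ‖y‖ ≤ t * r := by
    intro y hy
    rw [hKdef, mem_closedBall_iff_norm] at hy
    have h2 := (hcoord (y - p)).trans hy
    rw [PiLp.sub_apply, hpi] at h2
    have h3 := (abs_le.1 h2).1
    have h4 := norm_le_norm_add_norm_sub' y p
    rw [hpn] at h4
    constructor <;> linarith
  have hKvol : (volume : Measure (EuclideanSpace ℝ (Fin N))).real K = ((t - s) / 2 * r) ^ N * V := by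
    rw [hKdef, Measure.addHaar_real_closedBall _ _ (by positivity)]
    simp [hV]
  set G := m * (s * r) ^ α * (2 * t * r) ^ (-((N : ℝ) + 2 * α)) * ((volume : Measure (EuclideanSpace ℝ (Fin N))).real K)
    with hG
  have hGe : G = m * c1 * r ^ (-α) := by
    have hpw : r ^ α * r ^ (-((N : ℝ) + 2 * α)) * r ^ N = r ^ (-α) := by
      rw [← Real.rpow_natCast r N, ← Real.rpow_add hr0, ← Real.rpow_add hr0]
      congr 1; ring
    rw [hG, hKvol, hc1, Real.mul_rpow hs.le hr0.le, Real.mul_rpow (by positivity) hr0.le, mul_pow,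
      ← hpw]
    ring
  have hG0 : 0 < G := by rw [hGe]; positivity
  have comp := comparison hN h0 h1 c u hu_cont hu_nonneg (R := R) ?_ (by linarith) K
    Metric.isClosed_closedBall.measurableSet (measure_closedBall_lt_top.ne)
    (m * (s * r) ^ α) (2 * t * r) (by positivity) ?_ ?_ ?_ (G / (κ + 1)) (by positivity) ?_ e
  · have hwe : R ^ α ≤ ww α c R e := by
      have e1 : e - c = (1 - R) • e := by rw [hc, sub_smul, one_smul]
      unfold ww
      rw [e1, norm_smul, hen, mul_one, Real.norm_eq_abs, sq_abs,
        ← pospow_of_nonneg (by linarith : 0 ≤ R)]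
      apply pospow_mono h0
      nlinarith
    have h5 : G / (κ + 1) * R ^ α ≤ u e :=
      (mul_le_mul_of_nonneg_left hwe (by positivity)).trans comp
    rw [le_div_iff₀ hc20]
    refine le_trans (le_of_eq ?_) h5
    have hR' : R = s / 4 * r := by rw [hR]; ring
    rw [hGe, hc2, hR', Real.mul_rpow (by positivity) hr0.le]
    have : r ^ (-α) * r ^ α = 1 := by rw [← Real.rpow_add hr0]; simp
    calc m * (c1 * (s / 4) ^ α / (κ + 1))
        = m * c1 * (r ^ (-α) * r ^ α) / (κ + 1) * (s / 4) ^ α := by rw [this]; ring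
      _ = _ := by ring
  · intro x hx
    apply hu_super
    have h2 := (hcoord (x - c)).trans_lt hx
    rw [PiLp.sub_apply, hci] at h2
    have := (abs_lt.1 h2).1
    change 0 < x i
    linarith
  · intro y hy
    obtain ⟨h2, h3⟩ := hKi y hy
    have hsr0 : 0 < s * r := by positivity
    refine le_trans ?_ (hmu y (by linarith) (h2.trans ((le_abs_self _).trans (hcoord y))) h3)
    exact mul_le_mul_of_nonneg_left (Real.rpow_le_rpow hsr0.le h2 h0.le) hm0.le
  · intro y hy
    obtain ⟨h2, h3⟩ := hKi y hy
    have h4 := (le_abs_self _).trans (hcoord (y - c))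
    rw [PiLp.sub_apply, hci] at h4
    linarith
  · intro y hy x hx
    obtain ⟨h2, h3⟩ := hKi y hy
    have h4 := norm_sub_le y x
    have h5 := norm_le_norm_add_norm_sub' x c
    rw [hcn] at h5
    linarith
  · change G / (κ + 1) * κ < G
    rw [div_mul_eq_mul_div, div_lt_iff₀ (by linarith)]
    nlinarith
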